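/- arXiv:1401.2514 — 6 statements merged into one kernel-verified Lean document; each statement's English description precedes it below -/
import Mathlib

section
/- Let c_s, c_r be positive reals, let m̄, r, h_max, n₁, n₂ be natural numbers with r > m̄ ≥ 1, h_max ≥ 1, and n₁ ≤ r·(h_max − 1). If c_s / c_r ≥ m̄(m̄+1)(h_max − 1), then (c_s + n₁·c_r) / r ≤ (c_s + n₂·c_r) / m̄. -/
/-- Lemma 1 (arithmetic content): with `r` remaining sources, sink 1 covering all `r`
of them using `n₁ ≤ r(h_max−1)` relays and sink 2 covering `m̄ < r` of them using `n₂`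
relays, if `c_s/c_r ≥ m̄(m̄+1)(h_max−1)` then the greedy per-source cost of sink 1 is at
most that of sink 2. -/
theorem stmt_1 (c_s c_r : ℝ) (hcs : 0 < c_s) (hcr : 0 < c_r)
    (mbar r hmax n₁ n₂ : ℕ) (hr : mbar < r) (hmbar : 1 ≤ mbar) (hh : 1 ≤ hmax)
    (hn₁ : n₁ ≤ r * (hmax - 1))
    (hratio : c_s / c_r ≥ (mbar : ℝ) * ((mbar : ℝ) + 1) * ((hmax : ℝ) - 1)) :
    (c_s + (n₁ : ℝ) * c_r) / (r : ℝ) ≤ (c_s + (n₂ : ℝ) * c_r) / (mbar : ℝ) := by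
  have hm : (1 : ℝ) ≤ mbar := by exact_mod_cast hmbar
  have hmr : (mbar : ℝ) + 1 ≤ r := by exact_mod_cast hr
  have hH : (0 : ℝ) ≤ (hmax : ℝ) - 1 := sub_nonneg.mpr (by exact_mod_cast hh)
  have hn : (n₁ : ℝ) ≤ r * ((hmax : ℝ) - 1) := by
    have h : (n₁ : ℝ) ≤ ((r * (hmax - 1) : ℕ) : ℝ) := by exact_mod_cast hn₁
    rwa [Nat.cast_mul, Nat.cast_sub hh, Nat.cast_one] at h
  have hc : (mbar : ℝ) * (mbar + 1) * ((hmax : ℝ) - 1) * c_r ≤ c_s := (le_div_iff₀ hcr).mp hratio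
  have hr_le : (r : ℝ) ≤ (mbar + 1) * (r - mbar) := by
    linarith [mul_nonneg (zero_le_one.trans hm) (sub_nonneg.mpr hmr)]
  rw [div_le_div_iff₀ (by linarith) (by linarith)]
  have hrelay : (n₁ : ℝ) * c_r * mbar ≤ c_s * (r - mbar) :=
    calc (n₁ : ℝ) * c_r * mbar
        ≤ r * ((hmax : ℝ) - 1) * c_r * mbar := by gcongr
      _ ≤ (mbar + 1) * (r - mbar) * ((hmax : ℝ) - 1) * c_r * mbar := by gcongr
      _ = mbar * (mbar + 1) * ((hmax : ℝ) - 1) * c_r * (r - mbar) := by ring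
      _ ≤ c_s * (r - mbar) := mul_le_mul_of_nonneg_right hc (by linarith)
  have hn₂ : 0 ≤ (n₂ : ℝ) * c_r * r := by positivity
  linarith
end

section
/- Let c_s, c_r be positive reals, let m, m̄, h_max be natural numbers with m > m̄ ≥ 1 and h_max ≥ 1, and suppose c_s / c_r ≥ m̄(m̄+1)(h_max − 1). Let ε ∈ [0,1) be the real number such that ⌈m/(m̄+1)⌉ = m/(m̄+1) + ε. Then (⌈m/(m̄+1)⌉·c_s + m·(h_max − 1)·c_r) / (c_s + c_r) ≤ ε + m/m̄. -/
/-- Theorem 1, part 2 (arithmetic content): with `ε ∈ [0,1)` defined by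
`⌈m/(m̄+1)⌉ = m/(m̄+1) + ε`, under `c_s/c_r ≥ m̄(m̄+1)(h_max−1)`,
`(⌈m/(m̄+1)⌉·c_s + m·(h_max−1)·c_r)/(c_s + c_r) ≤ ε + m/m̄`. -/
theorem stmt_4 (c_s c_r : ℝ) (hcs : 0 < c_s) (hcr : 0 < c_r)
    (m mbar hmax : ℕ) (hm : mbar < m) (hmbar : 1 ≤ mbar) (hh : 1 ≤ hmax)
    (hratio : c_s / c_r ≥ (mbar : ℝ) * ((mbar : ℝ) + 1) * ((hmax : ℝ) - 1))
    (ε : ℝ) (hε0 : 0 ≤ ε) (hε1 : ε < 1)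
    (hεdef : (⌈(m : ℝ) / ((mbar : ℝ) + 1)⌉₊ : ℝ) = (m : ℝ) / ((mbar : ℝ) + 1) + ε) :
    ((⌈(m : ℝ) / ((mbar : ℝ) + 1)⌉₊ : ℝ) * c_s + (m : ℝ) * ((hmax : ℝ) - 1) * c_r) /
        (c_s + c_r) ≤ ε + (m : ℝ) / (mbar : ℝ) := by
  have hb : (0 : ℝ) < mbar := by exact_mod_cast hmbar
  have hrelay : (mbar : ℝ) * ((mbar : ℝ) + 1) * ((hmax : ℝ) - 1) * c_r ≤ c_s :=
    (le_div_iff₀ hcr).mp hratio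
  have hgap : (m : ℝ) * ((hmax : ℝ) - 1) * c_r ≤
      ((m : ℝ) / mbar - (m : ℝ) / ((mbar : ℝ) + 1)) * c_s := by
    have hdiff : ((m : ℝ) / mbar - (m : ℝ) / ((mbar : ℝ) + 1)) * c_s =
        m * c_s / (mbar * ((mbar : ℝ) + 1)) := by
      field_simp
      ring
    rw [hdiff, le_div_iff₀ (by positivity)]
    linarith [mul_le_mul_of_nonneg_left hrelay (Nat.cast_nonneg (α := ℝ) m)]
  rw [hεdef, div_le_iff₀ (by positivity)]
  have hslack : 0 ≤ (ε + (m : ℝ) / mbar) * c_r := by positivity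
  linarith
end

section
/- Let α be a real number with 0 < α ≤ 1, let m ≥ 1 be a natural number, and set m̄ = ⌈α·m⌉. Then ⌈m/(m̄+1)⌉ + m/(m̄·(m̄+1)) ≤ 1 + 1/α. -/
/-- Corollary 1 (arithmetic content): for `0 < α ≤ 1`, `m ≥ 1` and `m̄ = ⌈α·m⌉`,
`⌈m/(m̄+1)⌉ + m/(m̄(m̄+1)) ≤ 1 + 1/α`. -/
theorem stmt_5 (α : ℝ) (hα0 : 0 < α) (hα1 : α ≤ 1) (m : ℕ) (hm : 1 ≤ m)
    (mbar : ℕ) (hmbar : mbar = ⌈α * (m : ℝ)⌉₊) :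
    (⌈(m : ℝ) / ((mbar : ℝ) + 1)⌉₊ : ℝ) +
      (m : ℝ) / ((mbar : ℝ) * ((mbar : ℝ) + 1)) ≤ 1 + 1 / α := by
  have hm0 : (0 : ℝ) < m := by exact_mod_cast hm
  have hle : α * m ≤ mbar := hmbar ▸ Nat.le_ceil _
  have hk : (0 : ℝ) < mbar := (mul_pos hα0 hm0).trans_le hle
  have hceil : (⌈(m : ℝ) / ((mbar : ℝ) + 1)⌉₊ : ℝ) ≤ m / ((mbar : ℝ) + 1) + 1 :=
    (Nat.ceil_lt_add_one (by positivity)).le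
  have hsum : (m : ℝ) / ((mbar : ℝ) + 1) + m / ((mbar : ℝ) * ((mbar : ℝ) + 1)) = m / mbar := by
    field_simp
  have hratio : (m : ℝ) / mbar ≤ 1 / α := by
    rw [div_le_div_iff₀ hk hα0]
    linarith
  linarith
end

section
/- Let G be a finite simple graph with vertex set V, let s and t be distinct vertices of G, and let Y ⊆ V \ {s, t}. Then the following are equivalent: (i) there exists a path in G from s to t all of whose internal vertices belong to Y; (ii) for every minimal node cut C for (s, t), C ∩ Y ≠ ∅. -/
/-- A node cut for the pair `(s, t)`: a set of vertices avoiding `s` and `t` that meets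
every path in `G` from `s` to `t`. -/
def IsNodeCut {V : Type*} (G : SimpleGraph V) (s t : V) (C : Set V) : Prop :=
  C ⊆ ({s, t} : Set V)ᶜ ∧ ∀ p : G.Walk s t, p.IsPath → ∃ v ∈ C, v ∈ p.support

/-- A minimal node cut for `(s, t)`: a node cut none of whose proper subsets is a node
cut. -/
def IsMinimalNodeCut {V : Type*} (G : SimpleGraph V) (s t : V) (C : Set V) : Prop :=
  IsNodeCut G s t C ∧ ∀ C' : Set V, C' ⊂ C → ¬ IsNodeCut G s t C'

/-- The internal vertices of a walk from `s` to `t`: its support minus the endpoints. -/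
def internalVerts {V : Type*} {G : SimpleGraph V} {s t : V} (p : G.Walk s t) : Set V :=
  {v | v ∈ p.support} \ {s, t}

/-- In a finite graph, every node cut contains a minimal one. -/
theorem IsNodeCut.exists_isMinimalNodeCut_subset {V : Type*} [Finite V] {G : SimpleGraph V}
    {s t : V} {C : Set V} (hC : IsNodeCut G s t C) :
    ∃ D ⊆ C, IsMinimalNodeCut G s t D := by
  obtain ⟨D, hDC, hD⟩ := exists_minimal_le_of_wellFoundedLT (IsNodeCut G s t) C hC
  exact ⟨D, hDC, hD.prop, fun C' hC' => hD.not_prop_of_lt hC'⟩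

/-- Theorem 3 of the paper: for `Y ⊆ V \ {s,t}`, there is a path from `s` to `t` with
all internal vertices in `Y` iff `Y` meets every *minimal* node cut for `(s, t)`. -/
theorem stmt_8 {V : Type*} [Fintype V] (G : SimpleGraph V) (s t : V) (hst : s ≠ t)
    (Y : Set V) (hY : Y ⊆ ({s, t} : Set V)ᶜ) :
    (∃ p : G.Walk s t, p.IsPath ∧ internalVerts p ⊆ Y) ↔
      (∀ C : Set V, IsMinimalNodeCut G s t C → (C ∩ Y).Nonempty) := by
  constructor
  · rintro ⟨p, hp, hpY⟩ C ⟨⟨hCst, hC⟩, -⟩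
    obtain ⟨v, hvC, hvp⟩ := hC p hp
    exact ⟨v, hvC, hpY ⟨hvp, hCst hvC⟩⟩
  · intro h
    by_contra! hno
    have hcut : IsNodeCut G s t (({s, t} : Set V)ᶜ \ Y) := by
      refine ⟨Set.sdiff_subset, fun p hp => ?_⟩
      obtain ⟨v, ⟨hvp, hvst⟩, hvY⟩ := Set.not_subset.mp (hno p hp)
      exact ⟨v, ⟨hvst, hvY⟩, hvp⟩
    obtain ⟨D, hDC, hD⟩ := hcut.exists_isMinimalNodeCut_subset
    obtain ⟨v, hvD, hvY⟩ := h D hD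
    exact (hDC hvD).2 hvY
end

section
/- Let G be a finite simple graph with vertex set V, let k and b₀ be distinct vertices, let h be a natural number, and let Y ⊆ V \ {k, b₀} be a set with |Y| ≤ h such that Y ∩ C ≠ ∅ for every node cut C for (k, b₀). Then there exists a path in G from k to b₀ with at most h + 1 edges all of whose internal vertices belong to Y. -/
/-- A path with all internal vertices in a finite set `Y` has at most `Y.ncard + 1` edges. -/
theorem length_le_of_internalVerts_subset {V : Type*} {G : SimpleGraph V} {s t : V}
    {p : G.Walk s t} (hp : p.IsPath) {Y : Set V} (hY : Y.Finite) (hpY : internalVerts p ⊆ Y) :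
    p.length ≤ Y.ncard + 1 := by
  classical
  have hsub : (p.support.toFinset : Set V) ⊆ insert s (insert t Y) := by
    intro v hv
    by_cases hst : v ∈ ({s, t} : Set V)
    · rcases hst with rfl | rfl <;> simp
    · exact Or.inr (Or.inr (hpY ⟨by simpa using hv, hst⟩))
  have hle := Set.ncard_le_ncard hsub ((hY.insert t).insert s)
  rw [Set.ncard_coe_finset, List.toFinset_card_of_nodup hp.support_nodup,
    SimpleGraph.Walk.length_support] at hle
  have hs := Set.ncard_insert_le s (insert t Y)
  have ht := Set.ncard_insert_le t Y
  omega

/-- Lemma for Corollary (ilpcor2), graph content: if `Y ⊆ V \ {k, b₀}` has at most `h`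
elements and meets every node cut for `(k, b₀)`, then there is a path from `k` to `b₀`
with at most `h+1` edges whose internal vertices all lie in `Y`. -/
theorem stmt_11 {V : Type*} [Fintype V] (G : SimpleGraph V) (k b₀ : V) (hkb : k ≠ b₀)
    (h : ℕ) (Y : Set V) (hY : Y ⊆ ({k, b₀} : Set V)ᶜ) (hcard : Y.ncard ≤ h)
    (hcut : ∀ C : Set V, IsNodeCut G k b₀ C → (Y ∩ C).Nonempty) :
    ∃ p : G.Walk k b₀, p.IsPath ∧ p.length ≤ h + 1 ∧ internalVerts p ⊆ Y := by
  have hnot : ¬ IsNodeCut G k b₀ (Y ∪ {k, b₀})ᶜ := fun hC ↦ by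
    obtain ⟨v, hvY, hvC⟩ := hcut _ hC
    exact hvC (Or.inl hvY)
  have hC : (Y ∪ {k, b₀})ᶜ ⊆ ({k, b₀} : Set V)ᶜ :=
    Set.compl_subset_compl.mpr Set.subset_union_right
  obtain ⟨p, hp, hpC⟩ : ∃ p : G.Walk k b₀, p.IsPath ∧ ∀ v ∈ (Y ∪ {k, b₀})ᶜ, v ∉ p.support := by
    by_contra! hall
    exact hnot ⟨hC, hall⟩
  have hpY : internalVerts p ⊆ Y := fun v hv ↦
    (not_not.mp fun hvC ↦ hpC v hvC hv.1 : v ∈ Y ∪ {k, b₀}).resolve_right hv.2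
  exact ⟨p, hp, (length_le_of_internalVerts_subset hp Y.toFinite hpY).trans (by omega), hpY⟩
end

section
/- Let G be a finite simple graph with vertex set V, let b₀ ∈ V be a designated root (virtual sink), let Q ⊆ V \ {b₀} be a nonempty set of sources, let h be a natural number, and let c : V → ℝ≥0 be a cost function with c(v) = 0 for all v ∈ Q ∪ {b₀}. Assume that for every k ∈ Q there exists a path in G from k to b₀ with at most h + 1 edges. Then the minimum, over all families (Y_k)_{k ∈ Q} with Y_k ⊆ V \ {k, b₀}, |Y_k| ≤ h, and Y_k ∩ C ≠ ∅ for every node cut C for (k, b₀), of ∑_{j ∈ ⋃_{k ∈ Q} Y_k} c(j), equals the minimum, over all families of paths (p_k)_{k ∈ Q} where p_k is a path in G from k to b₀ with at most h + 1 edges, of ∑_{j ∈ ⋃_{k ∈ Q} I(p_k)} c(j), where I(p_k) denotes the set of internal vertices of p_k. -/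
theorem ncard_internalVerts_add_one {V : Type*} {G : SimpleGraph V} {s t : V} (hst : s ≠ t)
    {p : G.Walk s t} (hp : p.IsPath) : (internalVerts p).ncard + 1 = p.length := by
  classical
  have hcoe : {v | v ∈ p.support} = (p.support.toFinset : Set V) := by
    ext v
    simp
  have hcard : {v | v ∈ p.support}.ncard = p.length + 1 := by
    rw [hcoe, Set.ncard_coe_finset, List.toFinset_card_of_nodup hp.support_nodup,
      SimpleGraph.Walk.length_support]
  have hsub : ({s, t} : Set V) ⊆ {v | v ∈ p.support} := by
    rintro v (rfl | rfl) <;> simp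
  have hfin : {v | v ∈ p.support}.Finite := hcoe ▸ p.support.toFinset.finite_toSet
  have hdiff := Set.ncard_sdiff_add_ncard_of_subset hsub hfin
  rw [hcard, Set.ncard_pair hst] at hdiff
  unfold internalVerts
  omega

theorem IsNodeCut.internalVerts_inter_nonempty {V : Type*} {G : SimpleGraph V} {s t : V}
    {C : Set V} (hC : IsNodeCut G s t C) {p : G.Walk s t} (hp : p.IsPath) :
    (internalVerts p ∩ C).Nonempty := by
  obtain ⟨v, hvC, hvp⟩ := hC.2 p hp
  exact ⟨v, ⟨hvp, hC.1 hvC⟩, hvC⟩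

/-- A vertex set meeting every node cut contains the internal vertices of some path. -/
theorem exists_isPath_internalVerts_subset {V : Type*} {G : SimpleGraph V} {s t : V} {Y : Set V}
    (hY : ∀ C : Set V, IsNodeCut G s t C → (Y ∩ C).Nonempty) :
    ∃ p : G.Walk s t, p.IsPath ∧ internalVerts p ⊆ Y := by
  by_contra! hcon
  obtain ⟨v, hvY, hv⟩ := hY (Yᶜ \ {s, t}) ⟨fun v hv => hv.2, fun p hp => by
    obtain ⟨v, hv, hvY⟩ := Set.not_subset.1 (hcon p hp)
    exact ⟨v, ⟨hvY, hv.2⟩, hv.1⟩⟩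
  exact hv.1 hvY

theorem tsum_subtype_le_of_subset {V : Type*} [Finite V] (c : V → NNReal) {S T : Set V}
    (hST : S ⊆ T) : ∑' j : S, c j.1 ≤ ∑' j : T, c j.1 := by
  have := Fintype.ofFinite V
  rw [tsum_subtype S c, tsum_subtype T c, tsum_fintype, tsum_fintype]
  exact Finset.sum_le_sum fun v _ =>
    Set.indicator_le_indicator_of_subset hST (fun _ => zero_le) v

/-- Theorem 4 (ilp-main), graph content: the minimum cost over families `(Y_k)_{k∈Q}` of
vertex sets satisfying the node-cut and hop (cardinality) constraints equals the minimum
cost over families of hop-feasible paths from each source `k ∈ Q` to the root `b₀`. -/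
theorem stmt_12 {V : Type*} [Fintype V] (G : SimpleGraph V) (b₀ : V) (Q : Set V)
    (hQne : Q.Nonempty) (hQ : Q ⊆ ({b₀} : Set V)ᶜ) (h : ℕ) (c : V → NNReal)
    (hc : ∀ v ∈ Q ∪ {b₀}, c v = 0)
    (hfeas : ∀ k ∈ Q, ∃ p : G.Walk k b₀, p.IsPath ∧ p.length ≤ h + 1) :
    sInf {x : NNReal | ∃ Y : V → Set V,
        (∀ k ∈ Q, Y k ⊆ ({k, b₀} : Set V)ᶜ ∧ (Y k).ncard ≤ h ∧
          ∀ C : Set V, IsNodeCut G k b₀ C → (Y k ∩ C).Nonempty) ∧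
        x = ∑' j : (⋃ k ∈ Q, Y k), c j.1} =
    sInf {x : NNReal | ∃ P : (k : V) → k ∈ Q → G.Walk k b₀,
        (∀ (k : V) (hk : k ∈ Q), (P k hk).IsPath ∧ (P k hk).length ≤ h + 1) ∧
        x = ∑' j : (⋃ (k : V) (hk : k ∈ Q), internalVerts (P k hk)), c j.1} := by
  have hne : ∀ k ∈ Q, k ≠ b₀ := fun k hk => hQ hk
  have hpaths : ∀ P : (k : V) → k ∈ Q → G.Walk k b₀,
      (∀ (k : V) (hk : k ∈ Q), (P k hk).IsPath ∧ (P k hk).length ≤ h + 1) →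
      ∃ Y : V → Set V,
        (∀ k ∈ Q, Y k ⊆ ({k, b₀} : Set V)ᶜ ∧ (Y k).ncard ≤ h ∧
          ∀ C : Set V, IsNodeCut G k b₀ C → (Y k ∩ C).Nonempty) ∧
        (∑' j : (⋃ (k : V) (hk : k ∈ Q), internalVerts (P k hk)), c j.1) =
          ∑' j : (⋃ k ∈ Q, Y k), c j.1 := by
    intro P hP
    have hY : ∀ k (hk : k ∈ Q), (⋃ hk : k ∈ Q, internalVerts (P k hk)) =
        internalVerts (P k hk) := fun k hk => by simp [hk]
    refine ⟨fun k => ⋃ hk : k ∈ Q, internalVerts (P k hk), fun k hk => ?_, ?_⟩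
    · beta_reduce
      rw [hY k hk]
      refine ⟨fun v hv => hv.2, ?_, fun C hC => hC.internalVerts_inter_nonempty (hP k hk).1⟩
      have hcard := ncard_internalVerts_add_one (hne k hk) (hP k hk).1
      have hlen := (hP k hk).2
      omega
    · have hunion : (⋃ (k : V) (hk : k ∈ Q), internalVerts (P k hk)) =
          ⋃ k ∈ Q, ⋃ hk : k ∈ Q, internalVerts (P k hk) :=
        Set.iUnion_congr fun k => Set.iUnion_congr fun hk => (hY k hk).symm
      rw [hunion]
  choose P₀ hP₀ using hfeas
  apply le_antisymm
  · refine csInf_le_csInf (OrderBot.bddBelow _) ⟨_, P₀, hP₀, rfl⟩ ?_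
    rintro x ⟨P, hP, rfl⟩
    exact hpaths P hP
  · obtain ⟨Y₀, hY₀, -⟩ := hpaths P₀ hP₀
    refine le_csInf ⟨_, Y₀, hY₀, rfl⟩ ?_
    rintro x ⟨Y, hY, rfl⟩
    choose P hP hPY using fun k hk => exists_isPath_internalVerts_subset (hY k hk).2.2
    refine le_trans (csInf_le (OrderBot.bddBelow _) ?_)
      (tsum_subtype_le_of_subset c (Set.iUnion₂_mono hPY))
    refine ⟨P, fun k hk => ⟨hP k hk, ?_⟩, rfl⟩
    have hcard := ncard_internalVerts_add_one (hne k hk) (hP k hk)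
    have hle := (Set.ncard_le_ncard (hPY k hk) (Set.toFinite _)).trans (hY k hk).2.1
    omega
end
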